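/- Let f : U → 𝕃³ be a smooth immersion on an open set U ⊆ ℝ² with ⟨f_u, f_v⟩ ≡ 0 and E := ⟨f_u, f_u⟩ > 0, let G := ⟨f_v, f_v⟩, and let ψ : U → ℝ³ be a smooth map satisfying f_u × f_v = ε√E·(f_v − G·ψ) on U for some ε ∈ {1, −1}, together with ⟨ψ, ψ⟩ = 0, ⟨ψ, f_u⟩ = 0, ⟨ψ, f_v⟩ = 1. Then on all of U: f_u × ψ = −ε√E·ψ and f_v × ψ = (ε/√E)·f_u. -/

import Mathlib

noncomputable section

/-- The Minkowski inner product of signature (+,+,−) on ℝ³. -/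
def mink (x y : Fin 3 → ℝ) : ℝ := x 0 * y 0 + x 1 * y 1 - x 2 * y 2

/-- The Lorentzian vector product `v × w = S (v ×ₑ w)`, `S = diag(1,1,−1)`. -/
def lcross (v w : Fin 3 → ℝ) : Fin 3 → ℝ :=
  ![v 1 * w 2 - v 2 * w 1, v 2 * w 0 - v 0 * w 2, -(v 0 * w 1 - v 1 * w 0)]

/-- Partial derivative in the first coordinate direction. -/
def pu {E : Type*} [NormedAddCommGroup E] [NormedSpace ℝ E]
    (f : ℝ × ℝ → E) (q : ℝ × ℝ) : E :=
  fderiv ℝ f q (1, 0)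

/-- Partial derivative in the second coordinate direction. -/
def pv {E : Type*} [NormedAddCommGroup E] [NormedSpace ℝ E]
    (f : ℝ × ℝ → E) (q : ℝ × ℝ) : E :=
  fderiv ℝ f q (0, 1)

/-- Reciprocal-basis expansion: the products with `a`, `b`, `c` determine `x`, up to the factor
`⟨a × b, c⟩ = det (a, b, c)`. -/
theorem mink_lcross_smul_eq (a b c x : Fin 3 → ℝ) :
    mink (lcross a b) c • x =
      mink x a • lcross b c + mink x b • lcross c a + mink x c • lcross a b := by
  ext i
  fin_cases i <;> simp [mink, lcross] <;> ring

theorem eq_of_mink_eq {a b c x y : Fin 3 → ℝ} (h : mink (lcross a b) c ≠ 0)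
    (ha : mink x a = mink y a) (hb : mink x b = mink y b) (hc : mink x c = mink y c) :
    x = y := by
  apply smul_right_injective _ h
  simp only [mink_lcross_smul_eq, ha, hb, hc]

theorem mink_comm (x y : Fin 3 → ℝ) : mink x y = mink y x := by
  simp only [mink]; ring

theorem mink_smul_left (r : ℝ) (x y : Fin 3 → ℝ) : mink (r • x) y = r * mink x y := by
  simp only [mink, Pi.smul_apply, smul_eq_mul]; ring

theorem mink_sub_left (x y z : Fin 3 → ℝ) : mink (x - y) z = mink x z - mink y z := by
  simp only [mink, Pi.sub_apply]; ring

theorem mink_lcross_self_left (v w : Fin 3 → ℝ) : mink (lcross v w) v = 0 := by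
  simp [mink, lcross]; ring

theorem mink_lcross_self_right (v w : Fin 3 → ℝ) : mink (lcross v w) w = 0 := by
  simp [mink, lcross]; ring

theorem mink_lcross_rotate (u v w : Fin 3 → ℝ) :
    mink (lcross u v) w = mink (lcross v w) u := by
  simp [mink, lcross]; ring

theorem mink_lcross_swap (u v w : Fin 3 → ℝ) :
    mink (lcross u v) w = -mink (lcross u w) v := by
  simp [mink, lcross]; ring

/-- For an L-Gauss map `ψ` of `f` with sign `ε` (in L-coordinates),
one has `f_u × ψ = −ε√E·ψ` and `f_v × ψ = (ε/√E)·f_u` on all of `U`. -/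
theorem L_Gauss_map_cross_products
    (U : Set (ℝ × ℝ)) (hU : IsOpen U)
    (f : ℝ × ℝ → Fin 3 → ℝ) (hf : ContDiffOn ℝ (⊤ : ℕ∞) f U)
    (himm : ∀ q ∈ U, LinearIndependent ℝ ![pu f q, pv f q])
    (E G : ℝ × ℝ → ℝ)
    (hE : E = fun q => mink (pu f q) (pu f q))
    (hG : G = fun q => mink (pv f q) (pv f q))
    (hFzero : ∀ q ∈ U, mink (pu f q) (pv f q) = 0)
    (hEpos : ∀ q ∈ U, 0 < E q)
    (ε : ℝ) (hε : ε = 1 ∨ ε = -1)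
    (ψ : ℝ × ℝ → Fin 3 → ℝ) (hψ : ContDiffOn ℝ (⊤ : ℕ∞) ψ U)
    (hLG : ∀ q ∈ U, lcross (pu f q) (pv f q)
      = (ε * Real.sqrt (E q)) • (pv f q - G q • ψ q))
    (hψψ : ∀ q ∈ U, mink (ψ q) (ψ q) = 0)
    (hψu : ∀ q ∈ U, mink (ψ q) (pu f q) = 0)
    (hψv : ∀ q ∈ U, mink (ψ q) (pv f q) = 1) :
    ∀ q ∈ U,
      lcross (pu f q) (ψ q) = (-(ε * Real.sqrt (E q))) • ψ q ∧
      lcross (pv f q) (ψ q) = (ε / Real.sqrt (E q)) • pu f q := by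
  intro q hq
  have hE0 := hEpos q hq
  have hsqrt : Real.sqrt (E q) ≠ 0 := (Real.sqrt_pos.2 hE0).ne'
  have huu : mink (pu f q) (pu f q) = E q := by rw [hE]
  have hvψ : mink (pv f q) (ψ q) = 1 := by rw [mink_comm, hψv q hq]
  have hdet : mink (lcross (pu f q) (pv f q)) (ψ q) = ε * Real.sqrt (E q) := by
    rw [hLG q hq, mink_smul_left, mink_sub_left, mink_smul_left, hvψ, hψψ q hq]
    ring
  have hne : mink (lcross (pu f q) (pv f q)) (ψ q) ≠ 0 := by
    rw [hdet]
    rcases hε with rfl | rfl <;> simpa using hsqrt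
  constructor <;> apply eq_of_mink_eq hne
  · rw [mink_lcross_self_left, mink_smul_left, hψu q hq, mul_zero]
  · rw [mink_lcross_swap, hdet, mink_smul_left, hψv q hq, mul_one]
  · rw [mink_lcross_self_right, mink_smul_left, hψψ q hq, mul_zero]
  · rw [← mink_lcross_rotate, hdet, mink_smul_left, huu, div_mul_eq_mul_div, eq_div_iff hsqrt,
      mul_assoc, Real.mul_self_sqrt hE0.le]
  · rw [mink_lcross_self_left, mink_smul_left, hFzero q hq, mul_zero]
  · rw [mink_lcross_self_right, mink_smul_left, mink_comm, hψu q hq, mul_zero]
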